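/- Fix p ∈ [1, ∞). Let X be a complete separable metric space and let Q and Q' be probability measures on the p-Wasserstein space P_p(X) (with the W_p metric as ground metric) having finite p-th moments. Then the p-Wasserstein distance between the mixtures satisfies W_p(E_{μ∼Q} μ, E_{ν∼Q'} ν) ≤ W_p(Q, Q'), where W_p(Q, Q') is computed in the Wasserstein space over (P_p(X), W_p). -/

import Mathlib

open MeasureTheory ENNReal

/-- The `p`-Wasserstein distance associated with a general ground cost `c`:
`(inf over couplings γ of ∫ c(x,y)^p dγ)^(1/p)`. -/
noncomputable def wassersteinGen {X : Type*} [MeasurableSpace X]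
    (p : ℝ) (c : X → X → ℝ≥0∞) (μ ν : Measure X) : ℝ≥0∞ :=
  (⨅ γ ∈ {γ : Measure (X × X) |
      γ.map Prod.fst = μ ∧ γ.map Prod.snd = ν},
    ∫⁻ z, c z.1 z.2 ^ p ∂γ) ^ (1 / p)

/-- The `p`-Wasserstein distance on a pseudo-emetric space (ground cost = the distance). -/
noncomputable def wassersteinP {X : Type*} [MeasurableSpace X] [PseudoEMetricSpace X]
    (p : ℝ) (μ ν : Measure X) : ℝ≥0∞ :=
  wassersteinGen p (fun x y => edist x y) μ ν

namespace WMix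

open Filter Topology

/-- Closed convex epigraph of the finite transport problem. -/
def epi {I : Type*} [Fintype I] (k : I × I → ℝ) : Set ((I → ℝ) × (I → ℝ) × ℝ) :=
  {v | ∃ π ∈ stdSimplex ℝ (I × I), (fun i => ∑ j, π (i, j)) = v.1 ∧
    (fun j => ∑ i, π (i, j)) = v.2.1 ∧ ∑ z, k z * π z ≤ v.2.2}

lemma isClosed_epi {I : Type*} [Fintype I] (k : I × I → ℝ) : IsClosed (epi k) := by
  have h : IsClosed {q : stdSimplex ℝ (I × I) × ((I → ℝ) × (I → ℝ) × ℝ) |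
      (fun i => ∑ j, q.1.1 (i, j)) = q.2.1 ∧ (fun j => ∑ i, q.1.1 (i, j)) = q.2.2.1 ∧
        ∑ z, k z * q.1.1 z ≤ q.2.2.2} := by
    have hc : ∀ z, Continuous (fun q : stdSimplex ℝ (I × I) × ((I → ℝ) × (I → ℝ) × ℝ) =>
        q.1.1 z) := fun z =>
      (continuous_apply z).comp (continuous_subtype_val.comp continuous_fst)
    refine IsClosed.and ?_ (IsClosed.and ?_ ?_)
    · exact isClosed_eq (by fun_prop) (by fun_prop)
    · exact isClosed_eq (by fun_prop) (by fun_prop)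
    · exact isClosed_le (by fun_prop) (by fun_prop)
  have h2 := isClosedMap_snd_of_compactSpace _ h
  convert h2 using 1
  ext v
  constructor
  · rintro ⟨π, hπ, h1, h2, h3⟩
    exact ⟨(⟨π, hπ⟩, v), ⟨h1, h2, h3⟩, rfl⟩
  · rintro ⟨⟨π, w⟩, ⟨h1, h2, h3⟩, rfl⟩
    exact ⟨π.1, π.2, h1, h2, h3⟩

lemma convex_epi {I : Type*} [Fintype I] (k : I × I → ℝ) : Convex ℝ (epi k) := by
  rintro v ⟨π, hπ, h1, h2, h3⟩ w ⟨ρ, hρ, g1, g2, g3⟩ s t hs ht hst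
  refine ⟨s • π + t • ρ, convex_stdSimplex ℝ _ hπ hρ hs ht hst, ?_, ?_, ?_⟩
  · ext i
    simp [← h1, ← g1, Finset.sum_add_distrib, Finset.mul_sum]
  · ext i
    simp [← h2, ← g2, Finset.sum_add_distrib, Finset.mul_sum]
  · have : ∑ z, k z * (s • π + t • ρ) z = s * ∑ z, k z * π z + t * ∑ z, k z * ρ z := by
      simp only [Finset.mul_sum, ← Finset.sum_add_distrib]
      refine Finset.sum_congr rfl fun z _ => ?_
      simp
      ring
    rw [this]
    simp only [Prod.snd_add, Prod.smul_snd, smul_eq_mul]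
    gcongr

lemma finite_plan {Ω : Type*} [MeasurableSpace Ω] (Γ : Measure Ω) [IsProbabilityMeasure Γ]
    {I : Type*} [Fintype I] (k : I × I → ℝ) (hk : ∀ z, 0 ≤ k z) (a b : Ω → I → ℝ)
    (ham : Measurable a) (hbm : Measurable b)
    (ha : Integrable a Γ) (hb : Integrable b Γ) (w : Ω → ℝ≥0∞)
    (hex : ∀ᵐ ω ∂Γ, ∃ t, (a ω, b ω, t) ∈ epi k)
    (hw : ∀ᵐ ω ∂Γ, ∀ t : ℝ, w ω < ENNReal.ofReal t → (a ω, b ω, t) ∈ epi k)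
    (hM : ∫⁻ ω, w ω ∂Γ ≠ ⊤) :
    ∃ π ∈ stdSimplex ℝ (I × I), (∀ i, ∑ j, π (i, j) = ∫ ω, a ω i ∂Γ) ∧
      (∀ j, ∑ i, π (i, j) = ∫ ω, b ω j ∂Γ) ∧
      ENNReal.ofReal (∑ z, k z * π z) ≤ ∫⁻ ω, w ω ∂Γ := by
  classical
  have hmono : ∀ ω (s t : ℝ), s ≤ t → (a ω, b ω, s) ∈ epi k → (a ω, b ω, t) ∈ epi k := by
    rintro ω s t hst ⟨π, hπ, h1, h2, h3⟩
    exact ⟨π, hπ, h1, h2, h3.trans hst⟩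
  have hnn : ∀ ω (s : ℝ), (a ω, b ω, s) ∈ epi k → 0 ≤ s := by
    rintro ω s ⟨π, hπ, h1, h2, h3⟩
    exact (Finset.sum_nonneg fun z _ => mul_nonneg (hk z) (hπ.1 z)).trans h3
  let g : Ω → ℝ≥0∞ := fun ω => ⨅ q : ℚ, if (a ω, b ω, (q : ℝ)) ∈ epi k
    then ENNReal.ofReal (q : ℝ) else ⊤
  have hgle : ∀ ω (q : ℚ), (a ω, b ω, (q : ℝ)) ∈ epi k → g ω ≤ ENNReal.ofReal q := by
    intro ω q hq
    refine (iInf_le _ q).trans ?_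
    rw [if_pos hq]
  have hgm : Measurable g := by
    refine Measurable.iInf fun q => Measurable.ite ?_ measurable_const measurable_const
    exact (ham.prodMk (hbm.prodMk measurable_const)) (isClosed_epi k).measurableSet
  have hgw : ∀ᵐ ω ∂Γ, g ω ≤ w ω := by
    filter_upwards [hw] with ω hω
    by_contra! hlt
    obtain ⟨q, hq0, hq1, hq2⟩ := ENNReal.lt_iff_exists_rat_btwn.1 hlt
    refine absurd (hgle ω q (hω q hq1)) (not_le.2 hq2)
  have hgK : ∀ᵐ ω ∂Γ, (a ω, b ω, (g ω).toReal) ∈ epi k := by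
    filter_upwards [hex] with ω ⟨t, ht⟩
    obtain ⟨q0, hq0⟩ := exists_rat_gt t
    have hfin : g ω ≠ ⊤ := ne_top_of_le_ne_top ENNReal.ofReal_ne_top
      (hgle ω q0 (hmono ω t q0 hq0.le ht))
    have key : ∀ s : ℝ, (g ω).toReal < s → (a ω, b ω, s) ∈ epi k := by
      intro s hs
      have : g ω < ENNReal.ofReal s := (ENNReal.lt_ofReal_iff_toReal_lt hfin).2 hs
      obtain ⟨q, hq⟩ := iInf_lt_iff.1 this
      split_ifs at hq with hqk
      · refine hmono ω q s ?_ hqk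
        exact ((ENNReal.ofReal_lt_ofReal_iff_of_nonneg (hnn ω _ hqk)).1 hq).le
      · simp at hq
    have hlim : Tendsto (fun n : ℕ => (a ω, b ω, (g ω).toReal + 1 / ((n : ℝ) + 1))) atTop
        (𝓝 (a ω, b ω, (g ω).toReal)) := by
      refine tendsto_const_nhds.prodMk_nhds (tendsto_const_nhds.prodMk_nhds ?_)
      simpa using tendsto_const_nhds.add (tendsto_one_div_add_atTop_nhds_zero_nat (𝕜 := ℝ))
    refine (isClosed_epi k).mem_of_tendsto hlim (Eventually.of_forall fun n => key _ ?_)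
    have : (0 : ℝ) < 1 / ((n : ℝ) + 1) := by positivity
    linarith
  have hgM : ∫⁻ ω, g ω ∂Γ ≤ ∫⁻ ω, w ω ∂Γ := lintegral_mono_ae hgw
  have hgfin := ne_top_of_le_ne_top hM hgM
  have hgi : Integrable (fun ω => (g ω).toReal) Γ :=
    integrable_toReal_of_lintegral_ne_top hgm.aemeasurable hgfin
  have hmem := (convex_epi k).integral_mem (isClosed_epi k) hgK (ha.prodMk (hb.prodMk hgi))
  rw [integral_pair ha (hb.prodMk hgi), integral_pair hb hgi] at hmem
  obtain ⟨π, hπ, h1, h2, h3⟩ := hmem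
  refine ⟨π, hπ, fun i => ?_, fun i => ?_, ?_⟩
  · have := congrFun h1 i
    simp only at this
    rw [this]
    exact eval_integral (fun i => Integrable.eval ha i) i
  · have := congrFun h2 i
    simp only at this
    rw [this]
    exact eval_integral (fun i => Integrable.eval hb i) i
  · refine le_trans ?_ hgM
    rw [ENNReal.ofReal_le_iff_le_toReal hgfin]
    refine h3.trans (le_of_eq ?_)
    exact integral_toReal hgm.aemeasurable (ae_lt_top hgm hgfin)

lemma lift_plan {X : Type*} [MeasurableSpace X] (α β : Measure X) [IsProbabilityMeasure α]
    [IsProbabilityMeasure β] {I : Type*} [Fintype I] [MeasurableSpace I]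
    [MeasurableSingletonClass I] (T : X → I) (hT : Measurable T) (π : I × I → ℝ≥0∞)
    (h1 : ∀ i, ∑ j, π (i, j) = α (T ⁻¹' {i})) (h2 : ∀ j, ∑ i, π (i, j) = β (T ⁻¹' {j})) :
    ∃ γ : Measure (X × X), γ.map Prod.fst = α ∧ γ.map Prod.snd = β ∧
      ∀ z : I × I, γ ((T ⁻¹' {z.1}) ×ˢ (T ⁻¹' {z.2})) = π z := by
  classical
  have hms : ∀ i, MeasurableSet (T ⁻¹' {i}) := fun i => hT (measurableSet_singleton i)
  have hdec : ∀ μ : Measure X, ∑ i, μ.restrict (T ⁻¹' {i}) = μ := by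
    intro μ
    ext s hs
    rw [Measure.finsetSum_apply]
    simp only [Measure.restrict_apply hs]
    have := measure_biUnion_finset (μ := μ) (s := Finset.univ) (f := fun i => s ∩ T ⁻¹' {i})
      (by
        intro i _ j _ hij
        refine Set.disjoint_left.2 ?_
        rintro x ⟨_, hx⟩ ⟨_, hy⟩
        exact hij (hx.symm.trans hy)) (fun i _ => hs.inter (hms i))
    rw [← this]
    congr 1
    ext x
    simp
  have hle1 : ∀ z, π z ≤ α (T ⁻¹' {z.1}) := fun z => by
    rw [← h1]; exact Finset.single_le_sum (f := fun j => π (z.1, j)) (by simp) (Finset.mem_univ z.2)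
  have hle2 : ∀ z, π z ≤ β (T ⁻¹' {z.2}) := fun z => by
    rw [← h2]; exact Finset.single_le_sum (f := fun i => π (i, z.2)) (by simp) (Finset.mem_univ z.1)
  let c : I × I → ℝ≥0∞ := fun z => π z / (α (T ⁻¹' {z.1}) * β (T ⁻¹' {z.2}))
  have hc : ∀ z, c z * (α (T ⁻¹' {z.1}) * β (T ⁻¹' {z.2})) = π z := by
    intro z
    by_cases h0 : α (T ⁻¹' {z.1}) * β (T ⁻¹' {z.2}) = 0
    · rw [h0, mul_zero]
      rcases mul_eq_zero.1 h0 with h | h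
      · exact (le_antisymm ((hle1 z).trans h.le) bot_le).symm
      · exact (le_antisymm ((hle2 z).trans h.le) bot_le).symm
    · exact ENNReal.div_mul_cancel h0 (ENNReal.mul_ne_top (measure_ne_top _ _) (measure_ne_top _ _))
  let γ : Measure (X × X) :=
    ∑ z : I × I, c z • (α.restrict (T ⁻¹' {z.1})).prod (β.restrict (T ⁻¹' {z.2}))
  have happ : ∀ s t, MeasurableSet s → MeasurableSet t → γ (s ×ˢ t) =
      ∑ z : I × I, c z * (α (s ∩ T ⁻¹' {z.1}) * β (t ∩ T ⁻¹' {z.2})) := by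
    intro s t hs ht
    simp only [γ, Measure.finsetSum_apply, Measure.smul_apply, Measure.prod_prod, smul_eq_mul,
      Measure.restrict_apply hs, Measure.restrict_apply ht]
  refine ⟨γ, ?_, ?_, ?_⟩
  · ext s hs
    rw [Measure.map_apply measurable_fst hs, ← Set.prod_univ, happ s _ hs .univ]
    conv_rhs => rw [← hdec α]
    rw [Measure.finsetSum_apply, Fintype.sum_prod_type]
    refine Finset.sum_congr rfl fun i _ => ?_
    simp only [Set.univ_inter, Measure.restrict_apply hs]
    by_cases h0 : α (T ⁻¹' {i}) = 0
    · have : α (s ∩ T ⁻¹' {i}) = 0 := measure_mono_null Set.inter_subset_right h0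
      simp [this]
    · have hft : α (T ⁻¹' {i}) ≠ ⊤ := measure_ne_top _ _
      rw [← ENNReal.mul_right_inj h0 hft, Finset.mul_sum]
      have : ∀ j, α (T ⁻¹' {i}) * (c (i, j) * (α (s ∩ T ⁻¹' {i}) * β (T ⁻¹' {j}))) =
          π (i, j) * α (s ∩ T ⁻¹' {i}) := by
        intro j
        rw [← hc (i, j)]
        ring
      rw [Finset.sum_congr rfl fun j _ => this j, ← Finset.sum_mul, h1]
  · ext s hs
    rw [Measure.map_apply measurable_snd hs, ← Set.univ_prod, happ _ s .univ hs]
    conv_rhs => rw [← hdec β]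
    rw [Measure.finsetSum_apply, Fintype.sum_prod_type_right]
    refine Finset.sum_congr rfl fun i _ => ?_
    simp only [Set.univ_inter, Measure.restrict_apply hs]
    by_cases h0 : β (T ⁻¹' {i}) = 0
    · have : β (s ∩ T ⁻¹' {i}) = 0 := measure_mono_null Set.inter_subset_right h0
      simp [this]
    · have hft : β (T ⁻¹' {i}) ≠ ⊤ := measure_ne_top _ _
      rw [← ENNReal.mul_right_inj h0 hft, Finset.mul_sum]
      have : ∀ j, β (T ⁻¹' {i}) * (c (j, i) * (α (T ⁻¹' {j}) * β (s ∩ T ⁻¹' {i}))) =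
          π (j, i) * β (s ∩ T ⁻¹' {i}) := by
        intro j
        rw [← hc (j, i)]
        ring
      rw [Finset.sum_congr rfl fun j _ => this j, ← Finset.sum_mul, h2]
  · intro z
    rw [happ _ _ (hms _) (hms _), Finset.sum_eq_single z, Set.inter_self, Set.inter_self, hc]
    · intro y _ hy
      by_cases hy1 : y.1 = z.1
      · have hy2 : y.2 ≠ z.2 := fun h => hy (Prod.ext hy1 h)
        have : T ⁻¹' {z.2} ∩ T ⁻¹' {y.2} = ∅ := by
          ext x
          simp only [Set.mem_inter_iff, Set.mem_preimage, Set.mem_singleton_iff,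
            Set.mem_empty_iff_false, iff_false, not_and]
          intro h h'
          exact hy2 (h'.symm.trans h)
        simp [this]
      · have : T ⁻¹' {z.1} ∩ T ⁻¹' {y.1} = ∅ := by
          ext x
          simp only [Set.mem_inter_iff, Set.mem_preimage, Set.mem_singleton_iff,
            Set.mem_empty_iff_false, iff_false, not_and]
          intro h h'
          exact hy1 (h'.symm.trans h)
        simp [this]
    · simp

lemma lintegral_cells {X : Type*} [MeasurableSpace X] (γ : Measure (X × X))
    {I : Type*} [Fintype I] [MeasurableSpace I]
    [MeasurableSingletonClass I] (T : X → I) (hT : Measurable T) (k : I × I → ℝ≥0∞) :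
    ∫⁻ z, k (T z.1, T z.2) ∂γ = ∑ z, k z * γ ((T ⁻¹' {z.1}) ×ˢ (T ⁻¹' {z.2})) := by
  have hm : Measurable (fun z : X × X => (T z.1, T z.2)) := by fun_prop
  rw [← lintegral_map (f := k) (μ := γ) (measurable_of_countable k) hm, lintegral_fintype]
  refine Finset.sum_congr rfl fun z _ => ?_
  rw [Measure.map_apply hm (measurableSet_singleton z)]
  congr 2
  ext x
  simp [Prod.ext_iff]

lemma coupling_epi {X : Type*} [MeasurableSpace X] (μ ν : Measure X) [IsProbabilityMeasure μ]
    {I : Type*} [Fintype I] [MeasurableSpace I]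
    [MeasurableSingletonClass I] (T : X → I) (hT : Measurable T) (k : I × I → NNReal)
    (γ : Measure (X × X)) (h1 : γ.map Prod.fst = μ) (h2 : γ.map Prod.snd = ν)
    (t : ℝ) (ht : ∫⁻ z, (k (T z.1, T z.2) : ℝ≥0∞) ∂γ ≤ ENNReal.ofReal t) (ht0 : 0 ≤ t) :
    ((fun i => (μ (T ⁻¹' {i})).toReal), (fun i => (ν (T ⁻¹' {i})).toReal), t) ∈
      epi (fun z => (k z : ℝ)) := by
  classical
  have hms : ∀ i, MeasurableSet (T ⁻¹' {i}) := fun i => hT (measurableSet_singleton i)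
  have hγ : IsProbabilityMeasure γ := by
    constructor
    have := congrArg (fun m => m Set.univ) h1
    simpa [Measure.map_apply measurable_fst MeasurableSet.univ] using this
  have hs1 : ∀ i, ∑ j, γ ((T ⁻¹' {i}) ×ˢ (T ⁻¹' {j})) = μ (T ⁻¹' {i}) := by
    intro i
    rw [← h1, Measure.map_apply measurable_fst (hms i)]
    rw [← measure_biUnion_finset]
    · congr 1
      ext x
      simp
    · intro j _ j' _ hij
      refine Set.disjoint_left.2 ?_
      rintro x ⟨_, hx⟩ ⟨_, hy⟩
      exact hij (hx.symm.trans hy)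
    · exact fun j _ => (hms i).prod (hms j)
  have hs2 : ∀ j, ∑ i, γ ((T ⁻¹' {i}) ×ˢ (T ⁻¹' {j})) = ν (T ⁻¹' {j}) := by
    intro i
    rw [← h2, Measure.map_apply measurable_snd (hms i)]
    rw [← measure_biUnion_finset]
    · congr 1
      ext x
      simp
    · intro j _ j' _ hij
      refine Set.disjoint_left.2 ?_
      rintro x ⟨hx, _⟩ ⟨hy, _⟩
      exact hij (hx.symm.trans hy)
    · exact fun j _ => (hms j).prod (hms i)
  refine ⟨fun z => (γ ((T ⁻¹' {z.1}) ×ˢ (T ⁻¹' {z.2}))).toReal, ⟨fun z => by positivity, ?_⟩,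
    ?_, ?_, ?_⟩
  · rw [← ENNReal.toReal_sum (fun _ _ => measure_ne_top _ _)]
    have := lintegral_cells γ T hT (fun _ => 1)
    simp only [one_mul, lintegral_one, measure_univ] at this
    rw [← this]
    simp
  · ext i
    simp only
    rw [← ENNReal.toReal_sum (fun _ _ => measure_ne_top _ _), hs1]
  · ext i
    simp only
    rw [← ENNReal.toReal_sum (fun _ _ => measure_ne_top _ _), hs2]
  · rw [lintegral_cells γ T hT (fun z => (k z : ℝ≥0∞))] at ht
    have h3 := ENNReal.toReal_mono ENNReal.ofReal_ne_top ht
    rw [ENNReal.toReal_sum (fun _ _ => ENNReal.mul_ne_top (by simp) (measure_ne_top _ _)),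
      ENNReal.toReal_ofReal ht0] at h3
    simpa using h3

lemma exists_approx {X : Type*} [MeasurableSpace X]
    (Γ : Measure (Measure X × Measure X)) [IsProbabilityMeasure Γ]
    (hp1 : ∀ᵐ ω ∂Γ, IsProbabilityMeasure ω.1) (hp2 : ∀ᵐ ω ∂Γ, IsProbabilityMeasure ω.2)
    [IsProbabilityMeasure (Γ.map Prod.fst).join] [IsProbabilityMeasure (Γ.map Prod.snd).join]
    (c : X × X → ℝ≥0∞) (w : Measure X × Measure X → ℝ≥0∞)
    (hw : ∀ ω t, w ω < t → ∃ γ : Measure (X × X), γ.map Prod.fst = ω.1 ∧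
      γ.map Prod.snd = ω.2 ∧ ∫⁻ z, c z ∂γ ≤ t)
    (hM : ∫⁻ ω, w ω ∂Γ ≠ ⊤)
    {I : Type*} [Fintype I] [MeasurableSpace I]
    [MeasurableSingletonClass I] (T : X → I) (hT : Measurable T) (k : I × I → NNReal)
    (hk : ∀ x y, (k (T x, T y) : ℝ≥0∞) ≤ c (x, y)) :
    ∃ γ : Measure (X × X), γ.map Prod.fst = (Γ.map Prod.fst).join ∧
      γ.map Prod.snd = (Γ.map Prod.snd).join ∧
      ∫⁻ z, (k (T z.1, T z.2) : ℝ≥0∞) ∂γ ≤ ∫⁻ ω, w ω ∂Γ := by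
  classical
  have hms : ∀ i, MeasurableSet (T ⁻¹' {i}) := fun i => hT (measurableSet_singleton i)
  have hm1 : ∀ i, Measurable fun ω : Measure X × Measure X => ω.1 (T ⁻¹' {i}) := fun i =>
    (Measure.measurable_coe (hms i)).comp measurable_fst
  have hm2 : ∀ i, Measurable fun ω : Measure X × Measure X => ω.2 (T ⁻¹' {i}) := fun i =>
    (Measure.measurable_coe (hms i)).comp measurable_snd
  have hl1 : ∀ i, ∫⁻ ω, ω.1 (T ⁻¹' {i}) ∂Γ = (Γ.map Prod.fst).join (T ⁻¹' {i}) := by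
    intro i
    rw [Measure.join_apply (hms i), lintegral_map (Measure.measurable_coe (hms i)) measurable_fst]
  have hl2 : ∀ i, ∫⁻ ω, ω.2 (T ⁻¹' {i}) ∂Γ = (Γ.map Prod.snd).join (T ⁻¹' {i}) := by
    intro i
    rw [Measure.join_apply (hms i), lintegral_map (Measure.measurable_coe (hms i)) measurable_snd]
  have hf1 : ∀ i, ∫⁻ ω, ω.1 (T ⁻¹' {i}) ∂Γ ≠ ⊤ := fun i => by
    rw [hl1]; exact measure_ne_top _ _
  have hf2 : ∀ i, ∫⁻ ω, ω.2 (T ⁻¹' {i}) ∂Γ ≠ ⊤ := fun i => by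
    rw [hl2]; exact measure_ne_top _ _
  have hE1 : ∀ᵐ ω ∂Γ, ∃ t, ((fun i => (ω.1 (T ⁻¹' {i})).toReal), (fun i => (ω.2 (T ⁻¹' {i})).toReal), t) ∈
      epi (fun z => (k z : ℝ)) := by
    filter_upwards [hp1, hp2] with ω i1 i2
    have hfin : ∫⁻ z, (k (T z.1, T z.2) : ℝ≥0∞) ∂(ω.1.prod ω.2) ≠ ⊤ := by
      rw [lintegral_cells _ T hT (fun z => (k z : ℝ≥0∞))]
      exact ENNReal.sum_ne_top.2 fun z _ => ENNReal.mul_ne_top (by simp) (measure_ne_top _ _)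
    refine ⟨(∫⁻ z, (k (T z.1, T z.2) : ℝ≥0∞) ∂(ω.1.prod ω.2)).toReal,
      coupling_epi ω.1 ω.2 T hT k (ω.1.prod ω.2) ?_ ?_ _ ?_ (by positivity)⟩
    · simp [Measure.map_fst_prod]
    · simp [Measure.map_snd_prod]
    · rw [ENNReal.ofReal_toReal hfin]
  have hE2 : ∀ᵐ ω ∂Γ, ∀ t : ℝ, w ω < ENNReal.ofReal t → ((fun i => (ω.1 (T ⁻¹' {i})).toReal),
      (fun i => (ω.2 (T ⁻¹' {i})).toReal), t) ∈ epi (fun z => (k z : ℝ)) := by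
    filter_upwards [hp1, hp2] with ω i1 i2 t ht
    obtain ⟨γ, g1, g2, g3⟩ := hw ω _ ht
    refine coupling_epi ω.1 ω.2 T hT k γ g1 g2 t (le_trans ?_ g3) ?_
    · exact lintegral_mono fun z => hk z.1 z.2
    · have : 0 < ENNReal.ofReal t := bot_le.trans_lt ht
      exact (ENNReal.ofReal_pos.1 this).le
  obtain ⟨π, hπ, h1, h2, h3⟩ := finite_plan Γ (fun z => (k z : ℝ)) (fun z => (k z).2)
    (fun ω i => (ω.1 (T ⁻¹' {i})).toReal) (fun ω i => (ω.2 (T ⁻¹' {i})).toReal)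
    (measurable_pi_lambda _ fun i => (hm1 i).ennreal_toReal)
    (measurable_pi_lambda _ fun i => (hm2 i).ennreal_toReal)
    (Integrable.of_eval fun i =>
      integrable_toReal_of_lintegral_ne_top (hm1 i).aemeasurable (hf1 i))
    (Integrable.of_eval fun i =>
      integrable_toReal_of_lintegral_ne_top (hm2 i).aemeasurable (hf2 i))
    w hE1 hE2 hM
  obtain ⟨γ, g1, g2, g3⟩ := lift_plan (Γ.map Prod.fst).join (Γ.map Prod.snd).join T hT
    (fun z => ENNReal.ofReal (π z))
    (fun i => by
      rw [← ENNReal.ofReal_sum_of_nonneg (fun _ _ => hπ.1 _), h1,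
        integral_toReal (hm1 i).aemeasurable (ae_lt_top (hm1 i) (hf1 i)),
        ENNReal.ofReal_toReal (hf1 i), hl1])
    (fun i => by
      rw [← ENNReal.ofReal_sum_of_nonneg (fun _ _ => hπ.1 _), h2,
        integral_toReal (hm2 i).aemeasurable (ae_lt_top (hm2 i) (hf2 i)),
        ENNReal.ofReal_toReal (hf2 i), hl2])
  refine ⟨γ, g1, g2, ?_⟩
  rw [lintegral_cells γ T hT (fun z => (k z : ℝ≥0∞))]
  refine le_trans (le_of_eq ?_) h3
  rw [ENNReal.ofReal_sum_of_nonneg (fun z _ => mul_nonneg (NNReal.coe_nonneg (k z)) (hπ.1 z))]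
  refine Finset.sum_congr rfl fun z _ => ?_
  rw [g3, ENNReal.ofReal_mul (NNReal.coe_nonneg (k z)), ENNReal.ofReal_coe_nnreal]

/-- Truncated cost. -/
noncomputable def cut {X : Type*} [PseudoMetricSpace X] (p : ℝ) (ε R : NNReal) (z : X × X) :
    NNReal :=
  min ((nndist z.1 z.2 - ε) ^ p) R

/-- Finite cells with small cost oscillation. -/
lemma exists_cells {X : Type*} [MetricSpace X] [SecondCountableTopology X] [Nonempty X]
    [MeasurableSpace X] [BorelSpace X] (p : ℝ) (hp : 1 ≤ p)
    (α β : Measure X) [IsProbabilityMeasure α] [IsProbabilityMeasure β]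
    (ε : NNReal) (hε : 0 < ε) (η : ℝ≥0∞) (hη : 0 < η) :
    ∃ (N : ℕ) (T : X → (Fin N → Bool)) (k : (Fin N → Bool) × (Fin N → Bool) → NNReal)
      (B : Set X), Measurable T ∧ MeasurableSet B ∧ α Bᶜ ≤ η ∧ β Bᶜ ≤ η ∧
      (∀ x y, (k (T x, T y) : ℝ≥0∞) ≤ edist x y ^ p) ∧
      ∀ x ∈ B, ∀ y ∈ B, (nndist x y - 4 * ε) ^ p ≤ k (T x, T y) := by
  classical
  have hp0 : 0 ≤ p := by linarith
  let u := TopologicalSpace.denseSeq X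
  let B : ℕ → Set X := fun N => ⋃ i < N, Metric.ball (u i) ε
  have hBm : ∀ N, MeasurableSet (B N) := fun N =>
    MeasurableSet.biUnion (Set.to_countable _) fun i _ => Metric.isOpen_ball.measurableSet
  have hanti : Antitone fun N => (B N)ᶜ := by
    intro m n hmn
    refine Set.compl_subset_compl.2 ?_
    exact Set.biUnion_subset_biUnion_left fun i (hi : i < m) => lt_of_lt_of_le hi hmn
  have hempty : ⋂ N, (B N)ᶜ = ∅ := by
    rw [← Set.compl_iUnion, Set.compl_empty_iff, Set.eq_univ_iff_forall]
    intro x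
    obtain ⟨_, hi, ⟨i, rfl⟩⟩ := Metric.dense_iff.1 (TopologicalSpace.denseRange_denseSeq X) x ε hε
    refine Set.mem_iUnion.2 ⟨i + 1, Set.mem_biUnion (show i < i + 1 by omega) ?_⟩
    rw [Metric.mem_ball] at hi ⊢
    rw [dist_comm]; exact hi
  have hlim : ∀ μ : Measure X, IsProbabilityMeasure μ → ∀ᶠ N in atTop, μ (B N)ᶜ ≤ η := by
    intro μ _
    have := tendsto_measure_iInter_atTop (μ := μ)
      (fun N => (hBm N).compl.nullMeasurableSet) hanti ⟨0, measure_ne_top _ _⟩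
    rw [hempty, measure_empty] at this
    exact this.eventually_le_const hη
  obtain ⟨N, hN1, hN2⟩ := ((hlim α inferInstance).and (hlim β inferInstance)).exists
  let T : X → (Fin N → Bool) := fun x i => decide (x ∈ Metric.ball (u i) ε)
  have hT : Measurable T := by
    refine measurable_pi_lambda _ fun i => ?_
    refine measurable_to_bool ?_
    have : (fun x => decide (x ∈ Metric.ball (u i) (ε : ℝ))) ⁻¹' {true} = Metric.ball (u i) ε := by
      ext x
      simp
    rw [this]
    exact Metric.isOpen_ball.measurableSet
  let K : (Fin N → Bool) × (Fin N → Bool) → ℝ≥0∞ := fun s =>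
    ⨅ (z : X × X) (_ : T z.1 = s.1 ∧ T z.2 = s.2), edist z.1 z.2 ^ p
  have hK : ∀ x y, K (T x, T y) ≤ edist x y ^ p := fun x y =>
    iInf₂_le (x, y) ⟨rfl, rfl⟩
  have hKt : ∀ x y, K (T x, T y) ≠ ⊤ := fun x y =>
    ne_top_of_le_ne_top (ENNReal.rpow_ne_top_of_nonneg hp0 (edist_ne_top _ _)) (hK x y)
  have hclose : ∀ x ∈ B N, ∀ x', T x' = T x → nndist x x' ≤ 2 * ε := by
    intro x hx x' hxx
    obtain ⟨i, hi, hxi⟩ := Set.mem_iUnion₂.1 hx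
    have h1 := congrFun hxx ⟨i, hi⟩
    have h2 : x' ∈ Metric.ball (u i) ε := by
      simp only [T, decide_eq_decide] at h1
      exact h1.2 hxi
    rw [← NNReal.coe_le_coe, coe_nndist]
    push_cast
    have h3 := dist_triangle_right x x' (u i)
    rw [Metric.mem_ball] at hxi h2
    linarith
  refine ⟨N, T, fun s => (K s).toNNReal, B N, hT, hBm N, hN1, hN2, ?_, ?_⟩
  · intro x y
    rw [ENNReal.coe_toNNReal (hKt x y)]
    exact hK x y
  · intro x hx y hy
    rw [← ENNReal.coe_le_coe, ENNReal.coe_toNNReal (hKt x y)]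
    refine le_iInf₂ fun z hz => ?_
    rw [edist_nndist, ← ENNReal.coe_rpow_of_nonneg _ hp0, ENNReal.coe_le_coe]
    refine NNReal.rpow_le_rpow ?_ hp0
    rw [tsub_le_iff_right]
    have h1 := hclose x hx z.1 hz.1
    have h2 := hclose y hy z.2 hz.2
    have h3 := nndist_triangle x z.1 y
    have h4 := nndist_triangle z.1 z.2 y
    rw [nndist_comm z.2 y] at h4
    calc nndist x y ≤ nndist x z.1 + (nndist z.1 z.2 + nndist y z.2) := h3.trans (by gcongr)
      _ ≤ 2 * ε + (nndist z.1 z.2 + 2 * ε) := by gcongr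
      _ = _ := by ring

/-- Compactness step. -/
lemma exists_limit {X : Type*} [MetricSpace X] [CompleteSpace X] [SecondCountableTopology X]
    [MeasurableSpace X] [BorelSpace X] (p : ℝ) (hp : 1 ≤ p)
    (α β : Measure X) [IsProbabilityMeasure α] [IsProbabilityMeasure β] (M : ℝ≥0∞)
    (ε R : ℕ → NNReal) (δ : ℕ → ℝ≥0∞) (hε : Antitone ε) (hε0 : Tendsto ε atTop (𝓝 0))
    (hR : Monotone R) (hR0 : Tendsto R atTop atTop) (hδ : Tendsto δ atTop (𝓝 0))
    (h : ∀ n, ∃ γ : Measure (X × X), γ.map Prod.fst = α ∧ γ.map Prod.snd = β ∧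
      ∫⁻ z, (cut p (ε n) (R n) z : ℝ≥0∞) ∂γ ≤ M + δ n) :
    ∃ γ : Measure (X × X), γ.map Prod.fst = α ∧ γ.map Prod.snd = β ∧
      ∫⁻ z, edist z.1 z.2 ^ p ∂γ ≤ M := by
  have hp0 : 0 ≤ p := by linarith
  choose γ h1 h2 h3 using h
  have hprob : ∀ n, IsProbabilityMeasure (γ n) := by
    intro n
    constructor
    have := congrArg (fun m => m Set.univ) (h1 n)
    simpa [Measure.map_apply measurable_fst MeasurableSet.univ] using this
  let g : ℕ → ProbabilityMeasure (X × X) := fun n => ⟨γ n, hprob n⟩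
  have htight : IsTightMeasureSet
      {((μ : ProbabilityMeasure (X × X)) : Measure (X × X)) | μ ∈ Set.range g} := by
    rw [isTightMeasureSet_iff_exists_isCompact_measure_compl_le]
    intro e he
    have he2 : 0 < e / 2 := ENNReal.half_pos he.ne'
    obtain ⟨K1, hK1, hK1'⟩ := isTightMeasureSet_iff_exists_isCompact_measure_compl_le.1
      (isTightMeasureSet_singleton (μ := α)) (e / 2) he2
    obtain ⟨K2, hK2, hK2'⟩ := isTightMeasureSet_iff_exists_isCompact_measure_compl_le.1
      (isTightMeasureSet_singleton (μ := β)) (e / 2) he2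
    refine ⟨K1 ×ˢ K2, hK1.prod hK2, ?_⟩
    rintro _ ⟨_, ⟨n, rfl⟩, rfl⟩
    change γ n (K1 ×ˢ K2)ᶜ ≤ e
    have hsub : (K1 ×ˢ K2)ᶜ ⊆ Prod.fst ⁻¹' K1ᶜ ∪ Prod.snd ⁻¹' K2ᶜ := by
      intro x hx
      simp only [Set.mem_compl_iff, Set.mem_prod, Set.mem_union, Set.mem_preimage] at hx ⊢
      tauto
    calc γ n (K1 ×ˢ K2)ᶜ ≤ γ n (Prod.fst ⁻¹' K1ᶜ) + γ n (Prod.snd ⁻¹' K2ᶜ) :=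
          (measure_mono hsub).trans (measure_union_le _ _)
      _ = α K1ᶜ + β K2ᶜ := by
          rw [← h1 n, ← h2 n, Measure.map_apply measurable_fst hK1.measurableSet.compl,
            Measure.map_apply measurable_snd hK2.measurableSet.compl]
      _ ≤ e / 2 + e / 2 := add_le_add (hK1' α rfl) (hK2' β rfl)
      _ = e := ENNReal.add_halves e
  have hcomp := isCompact_closure_of_isTightMeasureSet htight
  obtain ⟨γ0, -, φ, hφ, hlim⟩ := hcomp.tendsto_subseq
    (x := g) (fun n => subset_closure (Set.mem_range_self n))
  refine ⟨γ0, ?_, ?_, ?_⟩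
  · have := ProbabilityMeasure.tendsto_map_of_tendsto_of_continuous _ _ hlim
      (continuous_fst (X := X) (Y := X))
    have hc : ∀ n, ((g ∘ φ) n).map (continuous_fst (X := X) (Y := X)).measurable.aemeasurable =
        (⟨α, inferInstance⟩ : ProbabilityMeasure X) := fun n => Subtype.ext (h1 (φ n))
    simp only [hc] at this
    have he := tendsto_nhds_unique this tendsto_const_nhds
    exact congrArg (fun m : ProbabilityMeasure X => (m : Measure X)) he
  · have := ProbabilityMeasure.tendsto_map_of_tendsto_of_continuous _ _ hlim
      (continuous_snd (X := X) (Y := X))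
    have hc : ∀ n, ((g ∘ φ) n).map (continuous_snd (X := X) (Y := X)).measurable.aemeasurable =
        (⟨β, inferInstance⟩ : ProbabilityMeasure X) := fun n => Subtype.ext (h2 (φ n))
    simp only [hc] at this
    have he := tendsto_nhds_unique this tendsto_const_nhds
    exact congrArg (fun m : ProbabilityMeasure X => (m : Measure X)) he
  · have hcont : ∀ n, Continuous (cut (X := X) p (ε n) (R n)) := by
      intro n
      unfold cut
      refine Continuous.min ?_ continuous_const
      exact (NNReal.continuous_rpow_const hp0).comp
        ((continuous_nndist).sub continuous_const)
    have hmono : ∀ z : X × X, Monotone fun n => cut p (ε n) (R n) z := by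
      intro z m n hmn
      unfold cut
      exact min_le_min (NNReal.rpow_le_rpow (tsub_le_tsub_left (hε hmn) _) hp0) (hR hmn)
    have hle : ∀ m, ∫⁻ z, (cut p (ε m) (R m) z : ℝ≥0∞) ∂(γ0 : Measure (X × X)) ≤ M := by
      intro m
      let f : BoundedContinuousFunction (X × X) NNReal :=
        BoundedContinuousFunction.mkOfBound ⟨cut p (ε m) (R m), hcont m⟩ (R m) (by
          intro x y
          rw [NNReal.dist_eq]
          have a1 : (cut p (ε m) (R m) x : ℝ) ≤ R m := NNReal.coe_le_coe.2 (min_le_right _ _)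
          have a2 : (cut p (ε m) (R m) y : ℝ) ≤ R m := NNReal.coe_le_coe.2 (min_le_right _ _)
          have a3 := (cut p (ε m) (R m) x).2
          have a4 := (cut p (ε m) (R m) y).2
          exact abs_sub_le_of_nonneg_of_le a3 a1 a4 a2)
      have ht := ProbabilityMeasure.tendsto_iff_forall_lintegral_tendsto.1 hlim f
      have hr : Tendsto (fun n => M + δ (φ n)) atTop (𝓝 M) := by
        simpa using tendsto_const_nhds.add (hδ.comp hφ.tendsto_atTop)
      refine le_of_tendsto_of_tendsto ht hr ?_
      filter_upwards [eventually_ge_atTop m] with n hn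
      refine le_trans (lintegral_mono fun z => ?_) (h3 (φ n))
      exact ENNReal.coe_le_coe.2 (hmono z (hn.trans (hφ.id_le n)))
    have htend : Tendsto (fun n => ∫⁻ z, (cut p (ε n) (R n) z : ℝ≥0∞) ∂(γ0 : Measure (X × X)))
        atTop (𝓝 (∫⁻ z, edist z.1 z.2 ^ p ∂(γ0 : Measure (X × X)))) := by
      refine lintegral_tendsto_of_tendsto_of_monotone
        (fun n => (hcont n).measurable.coe_nnreal_ennreal.aemeasurable)
        (Eventually.of_forall fun z m n hmn => ENNReal.coe_le_coe.2 (hmono z hmn))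
        (Eventually.of_forall fun z => ?_)
      rw [edist_nndist, ← ENNReal.coe_rpow_of_nonneg _ hp0, ENNReal.tendsto_coe]
      have ht1 : Tendsto (fun n => (nndist z.1 z.2 - ε n) ^ p) atTop (𝓝 (nndist z.1 z.2 ^ p)) := by
        have hs : Tendsto (fun n => nndist z.1 z.2 - ε n) atTop (𝓝 (nndist z.1 z.2)) := by
          simpa using (tendsto_const_nhds (x := nndist z.1 z.2)).sub hε0
        exact ((NNReal.continuous_rpow_const hp0).tendsto _).comp hs
      refine ht1.congr' ?_
      filter_upwards [hR0.eventually_ge_atTop (nndist z.1 z.2 ^ p)] with n hn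
      unfold cut
      rw [min_eq_left]
      exact (NNReal.rpow_le_rpow tsub_le_self hp0).trans hn
    exact le_of_tendsto' htend hle

lemma join_prob {X : Type*} [MeasurableSpace X] (Q : Measure (Measure X)) [IsProbabilityMeasure Q]
    (h : ∀ᵐ μ ∂Q, IsProbabilityMeasure μ) : IsProbabilityMeasure Q.join := by
  constructor
  rw [Measure.join_apply .univ]
  rw [lintegral_congr_ae (g := fun _ => 1) (by filter_upwards [h] with μ hμ; simp)]
  simp

end WMix

theorem wasserstein_mixture_le
    {X : Type*} [MetricSpace X] [CompleteSpace X] [SecondCountableTopology X]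
    [MeasurableSpace X] [BorelSpace X]
    (p : ℝ) (hp : 1 ≤ p)
    (Q Q' : Measure (Measure X))
    [IsProbabilityMeasure Q] [IsProbabilityMeasure Q']
    (hQae : ∀ᵐ μ ∂Q, IsProbabilityMeasure μ)
    (hQ'ae : ∀ᵐ ν ∂Q', IsProbabilityMeasure ν)
    (μ₀ : Measure X) (hμ₀ : IsProbabilityMeasure μ₀)
    (hQmom : ∫⁻ μ, wassersteinP p μ μ₀ ^ p ∂Q ≠ ⊤)
    (hQ'mom : ∫⁻ ν, wassersteinP p ν μ₀ ^ p ∂Q' ≠ ⊤) :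
    wassersteinP p Q.join Q'.join ≤
      wassersteinGen p (fun μ ν => wassersteinP p μ ν) Q Q' := by
  have hp0 : 0 < p := by linarith
  have hpne : p ≠ 0 := hp0.ne'
  rw [wassersteinP, wassersteinGen, wassersteinGen]
  refine ENNReal.rpow_le_rpow ?_ (by positivity)
  refine le_iInf₂ fun Γ hΓ => ?_
  obtain ⟨rfl, rfl⟩ := hΓ
  by_cases hM : ∫⁻ z, wassersteinP p z.1 z.2 ^ p ∂Γ = ⊤
  · rw [hM]; exact le_top
  have hΓp : IsProbabilityMeasure Γ :=
    Measure.isProbabilityMeasure_of_map Prod.fst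
  have hp1 : ∀ᵐ ω ∂Γ, IsProbabilityMeasure ω.1 := ae_of_ae_map measurable_fst.aemeasurable hQae
  have hp2 : ∀ᵐ ω ∂Γ, IsProbabilityMeasure ω.2 := ae_of_ae_map measurable_snd.aemeasurable hQ'ae
  have hj1 := WMix.join_prob _ hQae
  have hj2 := WMix.join_prob _ hQ'ae
  have hne : Nonempty X := nonempty_of_isProbabilityMeasure μ₀
  have hw : ∀ (ω : Measure X × Measure X) (t : ℝ≥0∞), wassersteinP p ω.1 ω.2 ^ p < t →
      ∃ γ : Measure (X × X), γ.map Prod.fst = ω.1 ∧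
      γ.map Prod.snd = ω.2 ∧ ∫⁻ z, edist z.1 z.2 ^ p ∂γ ≤ t := by
    intro ω t ht
    rw [wassersteinP, wassersteinGen, ← ENNReal.rpow_mul, one_div, inv_mul_cancel₀ hpne,
      ENNReal.rpow_one] at ht
    obtain ⟨γ, hγ⟩ := iInf_lt_iff.1 ht
    obtain ⟨hγ1, hγ2⟩ := iInf_lt_iff.1 hγ
    exact ⟨γ, hγ1.1, hγ1.2, hγ2.le⟩
  suffices h : ∃ γ : Measure (X × X), γ.map Prod.fst = (Γ.map Prod.fst).join ∧
      γ.map Prod.snd = (Γ.map Prod.snd).join ∧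
      ∫⁻ z, edist z.1 z.2 ^ p ∂γ ≤ ∫⁻ z, wassersteinP p z.1 z.2 ^ p ∂Γ by
    obtain ⟨γ, g1, g2, g3⟩ := h
    exact (iInf₂_le γ ⟨g1, g2⟩).trans g3
  refine WMix.exists_limit p hp (Γ.map Prod.fst).join (Γ.map Prod.snd).join
    (∫⁻ z, wassersteinP p z.1 z.2 ^ p ∂Γ)
    (fun n => 4 * (1 / ((n : NNReal) + 1))) (fun n => (n : NNReal))
    (fun n => ((1 / ((n : NNReal) + 1) : NNReal) : ℝ≥0∞)) ?_ ?_ ?_ ?_ ?_ ?_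
  · intro m n hmn
    simp only
    gcongr
  · simpa using (tendsto_one_div_add_atTop_nhds_zero_nat (𝕜 := NNReal)).const_mul 4
  · exact Nat.mono_cast
  · exact tendsto_natCast_atTop_atTop
  · rw [← ENNReal.coe_zero, ENNReal.tendsto_coe]
    exact tendsto_one_div_add_atTop_nhds_zero_nat (𝕜 := NNReal)
  · intro n
    let e : NNReal := 1 / ((n : NNReal) + 1)
    have he : 0 < e := by positivity
    let η : NNReal := e / (2 * ((n : NNReal) + 1))
    have hη : 0 < η := by positivity
    obtain ⟨N, T, k, B, hT, hB, hB1, hB2, hk1, hk2⟩ := WMix.exists_cells p hp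
      (Γ.map Prod.fst).join (Γ.map Prod.snd).join e he (η : ℝ≥0∞) (by exact_mod_cast hη)
    obtain ⟨γ, g1, g2, g3⟩ := WMix.exists_approx Γ hp1 hp2 (fun z => edist z.1 z.2 ^ p)
      (fun ω => wassersteinP p ω.1 ω.2 ^ p) hw hM T hT k hk1
    refine ⟨γ, g1, g2, ?_⟩
    let S : Set (X × X) := Prod.fst ⁻¹' Bᶜ ∪ Prod.snd ⁻¹' Bᶜ
    have hS : MeasurableSet S := (measurable_fst hB.compl).union (measurable_snd hB.compl)
    have hSγ : γ S ≤ 2 * η := by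
      refine (measure_union_le _ _).trans ?_
      rw [← Measure.map_apply measurable_fst hB.compl, ← Measure.map_apply measurable_snd hB.compl,
        g1, g2, two_mul]
      exact add_le_add hB1 hB2
    have hpt : ∀ z : X × X, (WMix.cut p (4 * e) (n : NNReal) z : ℝ≥0∞) ≤
        (k (T z.1, T z.2) : ℝ≥0∞) + S.indicator (fun _ => ((n : NNReal) : ℝ≥0∞)) z := by
      intro z
      by_cases hz : z ∈ S
      · rw [Set.indicator_of_mem hz]
        exact (ENNReal.coe_le_coe.2 (min_le_right _ _)).trans le_add_self
      · rw [Set.indicator_of_notMem hz, add_zero]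
        simp only [S, Set.mem_union, Set.mem_preimage, Set.mem_compl_iff, not_or, not_not] at hz
        exact ENNReal.coe_le_coe.2 ((min_le_left _ _).trans (hk2 _ hz.1 _ hz.2))
    refine (lintegral_mono hpt).trans ?_
    rw [lintegral_add_right _ (measurable_const.indicator hS), lintegral_indicator_const hS]
    refine add_le_add g3 ?_
    calc ((n : NNReal) : ℝ≥0∞) * γ S ≤ ((n : NNReal) : ℝ≥0∞) * (2 * η) := by gcongr
      _ = (((n : NNReal) * (2 * η) : NNReal) : ℝ≥0∞) := by push_cast; rfl
      _ ≤ (e : ℝ≥0∞) := by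
        refine ENNReal.coe_le_coe.2 ?_
        have : (n : NNReal) * (2 * η) = e * ((n : NNReal) / ((n : NNReal) + 1)) := by
          simp only [η]
          field_simp
        rw [this]
        refine mul_le_of_le_one_right he.le ?_
        exact div_le_one_of_le₀ (by simp) (by positivity)
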